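/- arXiv:2308.06846 — 2 statements merged into one kernel-verified Lean document; each statement's English description precedes it below -/
import Mathlib

section
/- Let p be a prime, K a quadratic extension of ℚ_p, and σ the nontrivial element of Gal(K/ℚ_p). Let η be a multiplicative character of K^× of finite conductor and ω a multiplicative character of ℚ_p^× of finite conductor with η·η^σ = ω ∘ N_{K/ℚ_p} on K^×. Then for all integers i, j ≥ 0, c(η^{i}(η^σ)^{j}) ≤ max{c(η), c(ω ∘ N_{K/ℚ_p})}. -/
open scoped Classical

set_option synthInstance.maxHeartbeats 400000
set_option maxHeartbeats 1000000

noncomputable section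

variable (p : ℕ) [Fact p.Prime]

/-- The unit filtration `U_0 = ℤ_p^×`, `U_i = 1 + p^i ℤ_p` (`i ≥ 1`) of `ℚ_p^×`. -/
def padicUnitLevelSet (i : ℕ) : Set ℚ_[p]ˣ :=
  if i = 0 then
    {u : ℚ_[p]ˣ | ∃ v : ℤ_[p]ˣ, ((v : ℤ_[p]) : ℚ_[p]) = (u : ℚ_[p])}
  else
    {u : ℚ_[p]ˣ | ∃ y : ℤ_[p], (u : ℚ_[p]) = 1 + (p : ℚ_[p]) ^ i * (y : ℚ_[p])}

/-- A multiplicative character of `ℚ_p^×` has finite conductor if it is trivial on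
`U_i` for some `i ≥ 0`. -/
def PadicCharHasFiniteConductor (χ : ℚ_[p]ˣ →* ℂˣ) : Prop :=
  ∃ i : ℕ, ∀ u ∈ padicUnitLevelSet p i, χ u = 1

/-- The conductor of a multiplicative character of `ℚ_p^×`: the least `i ≥ 0` such
that `χ` is trivial on `U_i`. -/
def padicCharConductor (χ : ℚ_[p]ˣ →* ℂˣ) : ℕ :=
  sInf {i : ℕ | ∀ u ∈ padicUnitLevelSet p i, χ u = 1}

/-- The unit filtration `U_0 = O_K^×`, `U_i = 1 + 𝔭_K^i` (`i ≥ 1`) of `K^×`, where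
`O_K` is the integral closure of `ℤ_p` in `K` and `𝔭_K` is its maximal ideal. -/
def unitLevelSet (K : Type*) [Field K] [Algebra ℤ_[p] K]
    [IsLocalRing (integralClosure ℤ_[p] K)] (i : ℕ) : Set Kˣ :=
  if i = 0 then
    {u : Kˣ | ∃ v : (integralClosure ℤ_[p] K)ˣ, ((v : integralClosure ℤ_[p] K) : K) = (u : K)}
  else
    {u : Kˣ | ∃ m : integralClosure ℤ_[p] K,
      m ∈ (IsLocalRing.maximalIdeal (integralClosure ℤ_[p] K)) ^ i ∧ (u : K) = 1 + (m : K)}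

variable {K : Type*} [Field K] [Algebra ℤ_[p] K] [IsLocalRing (integralClosure ℤ_[p] K)]

/-- A multiplicative character of `K^×` has finite conductor if it is trivial on `U_i`
for some `i ≥ 0`. -/
def CharHasFiniteConductor (χ : Kˣ →* ℂˣ) : Prop :=
  ∃ i : ℕ, ∀ u ∈ unitLevelSet p K i, χ u = 1

/-- The conductor `c(χ)`: the least `i ≥ 0` such that `χ` is trivial on `U_i`. -/
def charConductor (χ : Kˣ →* ℂˣ) : ℕ :=
  sInf {i : ℕ | ∀ u ∈ unitLevelSet p K i, χ u = 1}

/-- `K/ℚ_p` is unramified when its residue degree is `2`, i.e. the residue field of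
`O_K` has cardinality `p^2`. -/
def IsUnramifiedQuadratic (K : Type*) [Field K] [Algebra ℤ_[p] K]
    [IsLocalRing (integralClosure ℤ_[p] K)] : Prop :=
  Nat.card (IsLocalRing.ResidueField (integralClosure ℤ_[p] K)) = p ^ 2

/-- `K/ℚ_p` is ramified when its ramification index is `2`, i.e. `p ∈ 𝔭_K^2`. -/
def IsRamifiedQuadratic (K : Type*) [Field K] [Algebra ℤ_[p] K]
    [IsLocalRing (integralClosure ℤ_[p] K)] : Prop :=
  ((p : integralClosure ℤ_[p] K)) ∈ (IsLocalRing.maximalIdeal (integralClosure ℤ_[p] K)) ^ 2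

end

theorem aux_sigma_mem {p : ℕ} [Fact p.Prime]
    {K : Type*} [Field K] [Algebra ℚ_[p] K] [Algebra ℤ_[p] K]
    [IsScalarTower ℤ_[p] ℚ_[p] K] [IsLocalRing (integralClosure ℤ_[p] K)]
    (σ : K ≃ₐ[ℚ_[p]] K) (n : ℕ) (u : Kˣ) (hu : u ∈ unitLevelSet p K n) :
    Units.map (σ : K →* K) u ∈ unitLevelSet p K n := by
  let τ : integralClosure ℤ_[p] K ≃ₐ[ℤ_[p]] integralClosure ℤ_[p] K :=
    (σ.restrictScalars ℤ_[p]).mapIntegralClosure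
  have hτ : ∀ x, ((τ x : integralClosure ℤ_[p] K) : K) = σ x := fun x => rfl
  unfold unitLevelSet at hu ⊢
  split_ifs at hu ⊢ with h
  · obtain ⟨v, hv⟩ := hu
    refine ⟨Units.map (τ : _ →* _) v, ?_⟩
    change σ ((v : integralClosure ℤ_[p] K) : K) = σ u
    rw [hv]
  · obtain ⟨m, hm, hv⟩ := hu
    refine ⟨τ m, ?_, ?_⟩
    · have h1 := Ideal.mem_map_of_mem (τ : integralClosure ℤ_[p] K →+* integralClosure ℤ_[p] K) hm
      rw [Ideal.map_pow] at h1
      refine Ideal.pow_right_mono ?_ n h1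
      rw [Ideal.map_le_iff_le_comap]
      intro x hx
      rw [Ideal.mem_comap]
      rw [IsLocalRing.mem_maximalIdeal, mem_nonunits_iff] at hx ⊢
      intro hx'
      exact hx ((MulEquiv.isUnit_map τ).1 hx')
    · change σ u = _
      rw [hτ, hv, map_add, map_one]

/-- Let `p` be a prime, `K` a quadratic extension of `ℚ_p`, and `σ`
the nontrivial element of `Gal(K/ℚ_p)`. Let `η` be a multiplicative character of `K^×`
of finite conductor and `ω` a multiplicative character of `ℚ_p^×` of finite conductor
with `η·η^σ = ω ∘ N_{K/ℚ_p}` on `K^×`. Then for all integers `i, j ≥ 0`,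
`c(η^i (η^σ)^j) ≤ max {c(η), c(ω ∘ N_{K/ℚ_p})}`. -/
theorem conductor_eta_pow_le_max
    {p : ℕ} [Fact p.Prime]
    {K : Type*} [Field K] [Algebra ℚ_[p] K] [Algebra ℤ_[p] K]
    [IsScalarTower ℤ_[p] ℚ_[p] K] [IsLocalRing (integralClosure ℤ_[p] K)]
    (hquad : Module.finrank ℚ_[p] K = 2)
    (σ : K ≃ₐ[ℚ_[p]] K) (hσ : σ ≠ AlgEquiv.refl)
    (η : Kˣ →* ℂˣ) (hη : CharHasFiniteConductor p η)
    (ω : ℚ_[p]ˣ →* ℂˣ) (hω : PadicCharHasFiniteConductor p ω)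
    (hcent : ∀ x : Kˣ, η x * η (Units.map (σ : K →* K) x)
      = ω (Units.map (Algebra.norm ℚ_[p] (S := K)) x))
    (i j : ℕ) :
    charConductor p (η ^ i * (η.comp (Units.map (σ : K →* K))) ^ j)
      ≤ max (charConductor p η)
          (charConductor p (ω.comp (Units.map (Algebra.norm ℚ_[p] (S := K))))) := by
  refine le_trans ?_ (le_max_left _ _)
  have hc : ∀ u ∈ unitLevelSet p K (charConductor p η), η u = 1 := Nat.sInf_mem hη
  refine Nat.sInf_le ?_
  intro u hu
  have h1 := hc u hu
  have h2 := hc _ (aux_sigma_mem σ _ u hu)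
  simp only [MonoidHom.mul_apply, MonoidHom.pow_apply, MonoidHom.comp_apply]
  rw [h1, h2, one_pow, one_pow, one_mul]
end

section
/- Let p be a prime and K the unramified quadratic extension of ℚ_p (i.e., a quadratic extension of ℚ_p with residue degree 2). Then for every multiplicative character φ of ℚ_p^× of finite conductor, the character φ ∘ N_{K/ℚ_p} of K^× has conductor equal to c(φ), i.e., c(φ ∘ N_{K/ℚ_p}) = c(φ). -/
open scoped Classical

set_option synthInstance.maxHeartbeats 400000
set_option maxHeartbeats 1000000

set_option linter.unusedSectionVars false
open IsLocalRing Module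

section
attribute [local instance] Ideal.Quotient.field

lemma norm_quotient_mk' {R S : Type*} [CommRing R] [CommRing S] [Algebra R S] [Module.Free R S] [Module.Finite R S] [IsLocalRing R] (x : S) :
    Algebra.norm (R ⧸ maximalIdeal R) (Ideal.Quotient.mk (Ideal.map (algebraMap R S) (maximalIdeal R)) x) =
      Ideal.Quotient.mk (maximalIdeal R) (Algebra.norm R x) := by
  let ι := Module.Free.ChooseBasisIndex R S
  let b : Module.Basis ι R S := Module.Free.chooseBasis R S
  rw [Algebra.norm_eq_matrix_det b, Algebra.norm_eq_matrix_det (basisQuotient b), RingHom.map_det]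
  congr 1
  ext i j
  simp only [Algebra.leftMulMatrix_apply, Algebra.coe_lmul_eq_mul, LinearMap.toMatrix_apply,
    basisQuotient_apply, LinearMap.mul_apply', RingHom.mapMatrix_apply,
    Matrix.map_apply, ← map_mul, basisQuotient_repr]

variable {p : ℕ} [Fact p.Prime] {S : Type*} [CommRing S] [Algebra ℤ_[p] S] [Module.Free ℤ_[p] S]
  [Module.Finite ℤ_[p] S] [IsLocalRing S]

lemma aux_card_res : Nat.card (ℤ_[p] ⧸ maximalIdeal ℤ_[p]) = p := by
  have e : ResidueField ℤ_[p] ≃+* ZMod p := PadicInt.residueField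
  exact (Nat.card_congr e.toEquiv).trans (Nat.card_zmod p)

lemma aux_max (h2 : finrank ℤ_[p] S = 2) (hc : Nat.card (ResidueField S) = p ^ 2) :
    Ideal.map (algebraMap ℤ_[p] S) (maximalIdeal ℤ_[p]) = maximalIdeal S := by
  set I := Ideal.map (algebraMap ℤ_[p] S) (maximalIdeal ℤ_[p]) with hI
  have hp := (Fact.out : p.Prime)
  have hcI : Nat.card (S ⧸ I) = p ^ 2 := by
    have := Module.Finite.of_restrictScalars_finite ℤ_[p] (ℤ_[p] ⧸ maximalIdeal ℤ_[p]) (S ⧸ I)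
    have h := Module.natCard_eq_pow_finrank (K := ℤ_[p] ⧸ maximalIdeal ℤ_[p]) (V := S ⧸ I)
    rw [h, finrank_quotient_map, h2, aux_card_res]
  have hfin : Finite (S ⧸ I) := Nat.finite_of_card_ne_zero (by rw [hcI]; exact pow_ne_zero _ hp.ne_zero)
  have hle : I ≤ maximalIdeal S := by
    apply le_maximalIdeal
    intro h
    have : Subsingleton (S ⧸ I) := Ideal.Quotient.subsingleton_iff.mpr h
    have h1 := Nat.card_of_subsingleton (0 : S ⧸ I)
    rw [hcI] at h1
    have := hp.one_lt
    nlinarith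
  apply le_antisymm hle
  have hs := Ideal.Quotient.factor_surjective hle
  have hb := (Nat.bijective_iff_surjective_and_card (Ideal.Quotient.factor hle)).mpr ⟨hs, hcI.trans hc.symm⟩
  intro x hx
  rw [← Ideal.Quotient.eq_zero_iff_mem]
  apply hb.1
  rw [Ideal.Quotient.factor_mk, map_zero]
  exact Ideal.Quotient.eq_zero_iff_mem.mpr hx

lemma aux_surj (h2 : finrank ℤ_[p] S = 2) (hc : Nat.card (ResidueField S) = p ^ 2) :
    (∃ t : S, IsUnit (Algebra.trace ℤ_[p] S t)) ∧
    (∀ u : ℤ_[p], ∃ x : S, u - Algebra.norm ℤ_[p] x ∈ maximalIdeal ℤ_[p]) := by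
  have hm := aux_max h2 hc
  have hmax : (Ideal.map (algebraMap ℤ_[p] S) (maximalIdeal ℤ_[p])).IsMaximal := by
    rw [hm]; infer_instance
  have hp := (Fact.out : p.Prime)
  have hfin0 : Finite (ℤ_[p] ⧸ maximalIdeal ℤ_[p]) := 
    Nat.finite_of_card_ne_zero (by rw [aux_card_res]; exact hp.ne_zero)
  have := Module.Finite.of_restrictScalars_finite ℤ_[p] (ℤ_[p] ⧸ maximalIdeal ℤ_[p]) 
    (S ⧸ (Ideal.map (algebraMap ℤ_[p] S) (maximalIdeal ℤ_[p])))
  have hfin : Finite (S ⧸ (Ideal.map (algebraMap ℤ_[p] S) (maximalIdeal ℤ_[p]))) := 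
    Module.finite_of_finite (ℤ_[p] ⧸ maximalIdeal ℤ_[p])
  constructor
  · obtain ⟨y, hy⟩ := Algebra.trace_surjective (ℤ_[p] ⧸ maximalIdeal ℤ_[p])
      (S ⧸ (Ideal.map (algebraMap ℤ_[p] S) (maximalIdeal ℤ_[p]))) 1
    obtain ⟨t, rfl⟩ := Ideal.Quotient.mk_surjective y
    refine ⟨t, ?_⟩
    rw [Algebra.trace_quotient_mk] at hy
    by_contra h
    rw [← mem_nonunits_iff, ← mem_maximalIdeal, ← Ideal.Quotient.eq_zero_iff_mem, hy] at h
    exact one_ne_zero h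
  · intro u
    obtain ⟨y, hy⟩ := FiniteField.norm_surjective (ℤ_[p] ⧸ maximalIdeal ℤ_[p])
      (S ⧸ (Ideal.map (algebraMap ℤ_[p] S) (maximalIdeal ℤ_[p]))) (Ideal.Quotient.mk _ u)
    obtain ⟨t, rfl⟩ := Ideal.Quotient.mk_surjective y
    refine ⟨t, ?_⟩
    rw [norm_quotient_mk'] at hy
    rw [← Ideal.Quotient.eq, hy]

lemma aux_norm_one_add (h2 : finrank ℤ_[p] S = 2) (x : S) :
    Algebra.norm ℤ_[p] (1 + x) = 1 + Algebra.trace ℤ_[p] S x + Algebra.norm ℤ_[p] x := by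
  let b := Module.finBasisOfFinrankEq ℤ_[p] S h2
  rw [Algebra.norm_eq_matrix_det b, Algebra.norm_eq_matrix_det b, Algebra.trace_eq_matrix_trace b,
    map_add, map_one, Matrix.det_fin_two, Matrix.det_fin_two, Matrix.trace_fin_two]
  simp
  ring

lemma aux_norm_one_add_mul (h2 : finrank ℤ_[p] S = 2) (a : ℤ_[p]) (x : S) :
    Algebra.norm ℤ_[p] (1 + algebraMap ℤ_[p] S a * x) = 1 + a * Algebra.trace ℤ_[p] S x + a ^ 2 * Algebra.norm ℤ_[p] x := by
  rw [aux_norm_one_add h2, map_mul (Algebra.norm ℤ_[p]), Algebra.norm_algebraMap_of_basis (Module.finBasisOfFinrankEq ℤ_[p] S h2),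
   ← Algebra.smul_def, map_smul]
  simp

lemma aux_mem_max (h2 : finrank ℤ_[p] S = 2) (hc : Nat.card (ResidueField S) = p ^ 2) (i : ℕ) (x : S) :
    x ∈ maximalIdeal S ^ i ↔ ∃ t, x = algebraMap ℤ_[p] S (p ^ i) * t := by
  rw [← aux_max h2 hc, PadicInt.maximalIdeal_eq_span_p, Ideal.map_span, Set.image_singleton,
    Ideal.span_singleton_pow, Ideal.mem_span_singleton, ← map_pow]
  rfl

lemma aux_mem_max_p (i : ℕ) (x : ℤ_[p]) :
    x ∈ maximalIdeal ℤ_[p] ^ i ↔ ∃ t, x = p ^ i * t := by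
  rw [PadicInt.maximalIdeal_eq_span_p,
    Ideal.span_singleton_pow, Ideal.mem_span_singleton]
  rfl

lemma aux_unit_one_add {R : Type*} [CommRing R] [IsLocalRing R] {i : ℕ} (hi : i ≠ 0) {x : R}
    (hx : x ∈ maximalIdeal R ^ i) : IsUnit (1 + x) := by
  by_contra h
  rw [← mem_nonunits_iff, ← mem_maximalIdeal] at h
  have := (maximalIdeal R).sub_mem h (Ideal.pow_le_self hi hx)
  rw [add_sub_cancel_right] at this
  exact (mem_maximalIdeal _).mp this isUnit_one

lemma aux_approx (h2 : finrank ℤ_[p] S = 2) (hc : Nat.card (ResidueField S) = p ^ 2) (j : ℕ)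
    (v : ℤ_[p]ˣ) (y : ℤ_[p]) (hv : (v : ℤ_[p]) = 1 + p ^ j * y) :
    ∃ w : Sˣ, (∃ t, (w : S) = 1 + algebraMap ℤ_[p] S (p ^ j) * t) ∧
      ∃ z, (v : ℤ_[p]) = Algebra.norm ℤ_[p] (w : S) + p ^ (j + 1) * z := by
  obtain ⟨⟨t, τ, hτ⟩, hn⟩ := aux_surj h2 hc
  by_cases hj : j = 0
  · subst hj
    obtain ⟨x, hx⟩ := hn v
    have hu : IsUnit x := by
      by_contra h
      rw [← mem_nonunits_iff, ← mem_maximalIdeal, ← pow_one (maximalIdeal S), aux_mem_max h2 hc] at h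
      obtain ⟨s, rfl⟩ := h
      rw [map_mul, Algebra.norm_algebraMap_of_basis (Module.finBasisOfFinrankEq ℤ_[p] S h2)] at hx
      have h3 : ((p : ℤ_[p]) ^ 1) ^ Fintype.card (Fin 2) * Algebra.norm ℤ_[p] s ∈ maximalIdeal ℤ_[p] := by
        rw [PadicInt.maximalIdeal_eq_span_p, Ideal.mem_span_singleton]
        exact ⟨p * Algebra.norm ℤ_[p] s, by simp; ring⟩
      have h4 := (maximalIdeal ℤ_[p]).add_mem hx h3
      rw [sub_add_cancel] at h4
      exact (mem_maximalIdeal _).mp h4 v.isUnit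
    obtain ⟨w, rfl⟩ := hu
    refine ⟨w, ⟨w - 1, by simp⟩, ?_⟩
    rw [← pow_one (maximalIdeal _), aux_mem_max_p] at hx
    obtain ⟨z, hz⟩ := hx
    exact ⟨z, by simpa using sub_eq_iff_eq_add'.mp hz⟩
  · let s : S := algebraMap ℤ_[p] S (y * (τ⁻¹ : ℤ_[p]ˣ)) * t
    obtain ⟨w, hw⟩ := aux_unit_one_add (R := S) hj ((aux_mem_max h2 hc j _).mpr ⟨s, rfl⟩)
    refine ⟨w, ⟨s, hw⟩, -(p ^ (j - 1) * Algebra.norm ℤ_[p] s), ?_⟩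
    rw [hw, aux_norm_one_add_mul h2, hv]
    have : Algebra.trace ℤ_[p] S s = y := by
      simp only [s]
      rw [← Algebra.smul_def, map_smul, ← hτ]
      simp
    rw [this]
    obtain ⟨k, rfl⟩ := Nat.exists_eq_succ_of_ne_zero hj
    simp
    ring
end

section
variable {p : ℕ} [Fact p.Prime]

lemma aux_memV (i : ℕ) (u : ℚ_[p]ˣ) : u ∈ padicUnitLevelSet p i ↔
    ∃ v : ℤ_[p]ˣ, ((v : ℤ_[p]) : ℚ_[p]) = u ∧ ∃ y, (v : ℤ_[p]) = 1 + p ^ i * y := by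
  unfold padicUnitLevelSet
  split_ifs with hi
  · subst hi
    constructor
    · rintro ⟨v, hv⟩
      exact ⟨v, hv, v - 1, by simp⟩
    · rintro ⟨v, hv, -⟩
      exact ⟨v, hv⟩
  · constructor
    · rintro ⟨y, hy⟩
      obtain ⟨v, hv⟩ := aux_unit_one_add hi ((aux_mem_max_p i _).mpr ⟨y, rfl⟩)
      refine ⟨v, ?_, y, hv⟩
      rw [hv, hy]
      push_cast
      rfl
    · rintro ⟨v, hv, y, hy⟩
      refine ⟨y, ?_⟩
      rw [← hv, hy]
      push_cast
      rfl

lemma aux_memW {K : Type*} [Field K] [Algebra ℤ_[p] K]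
    [IsLocalRing (integralClosure ℤ_[p] K)] [Module.Free ℤ_[p] (integralClosure ℤ_[p] K)]
    [Module.Finite ℤ_[p] (integralClosure ℤ_[p] K)]
    (h2 : finrank ℤ_[p] (integralClosure ℤ_[p] K) = 2)
    (hc : Nat.card (ResidueField (integralClosure ℤ_[p] K)) = p ^ 2) (i : ℕ) (u : Kˣ) :
    u ∈ unitLevelSet p K i ↔
    ∃ v : (integralClosure ℤ_[p] K)ˣ, ((v : integralClosure ℤ_[p] K) : K) = u ∧
      ∃ t, (v : integralClosure ℤ_[p] K) = 1 + algebraMap ℤ_[p] _ (p ^ i) * t := by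
  unfold unitLevelSet
  split_ifs with hi
  · subst hi
    constructor
    · rintro ⟨v, hv⟩
      exact ⟨v, hv, v - 1, by simp⟩
    · rintro ⟨v, hv, -⟩
      exact ⟨v, hv⟩
  · constructor
    · rintro ⟨m, hm, hy⟩
      obtain ⟨v, hv⟩ := aux_unit_one_add hi hm
      obtain ⟨t, rfl⟩ := (aux_mem_max h2 hc i m).mp hm
      refine ⟨v, ?_, t, hv⟩
      rw [hv, hy]
      rfl
    · rintro ⟨v, hv, t, ht⟩
      refine ⟨_, (aux_mem_max h2 hc i _).mpr ⟨t, rfl⟩, ?_⟩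
      rw [← hv, ht]
      rfl

lemma aux_V_succ {i : ℕ} {u : ℚ_[p]ˣ} (h : u ∈ padicUnitLevelSet p (i + 1)) :
    u ∈ padicUnitLevelSet p i := by
  rw [aux_memV] at h ⊢
  obtain ⟨v, hv, y, hy⟩ := h
  exact ⟨v, hv, p * y, by rw [hy]; ring⟩
end

/-- Let `p` be a prime and `K` the unramified quadratic extension of
`ℚ_p` (i.e. a quadratic extension of `ℚ_p` with residue degree `2`). Then for every
multiplicative character `φ` of `ℚ_p^×` of finite conductor, the character
`φ ∘ N_{K/ℚ_p}` of `K^×` has conductor `c(φ ∘ N_{K/ℚ_p}) = c(φ)`. -/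
theorem conductor_comp_norm_unramified
    {p : ℕ} [Fact p.Prime]
    {K : Type*} [Field K] [Algebra ℚ_[p] K] [Algebra ℤ_[p] K]
    [IsScalarTower ℤ_[p] ℚ_[p] K] [IsLocalRing (integralClosure ℤ_[p] K)]
    (hquad : Module.finrank ℚ_[p] K = 2)
    (hunram : IsUnramifiedQuadratic p K)
    (φ : ℚ_[p]ˣ →* ℂˣ) (hφ : PadicCharHasFiniteConductor p φ) :
    charConductor p (φ.comp (Units.map (Algebra.norm ℚ_[p] (S := K))))
      = padicCharConductor p φ := by
  have hchar : CharZero ℚ_[p] := inferInstance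
  have : FiniteDimensional ℚ_[p] K := Module.finite_of_finrank_eq_succ hquad
  have : Module.IsTorsionFree ℤ_[p] K := Module.IsTorsionFree.trans_faithfulSMul ℤ_[p] ℚ_[p] K
  have hfree : Module.Free ℤ_[p] (integralClosure ℤ_[p] K) :=
    IsIntegralClosure.module_free ℤ_[p] ℚ_[p] K _
  have hfin : Module.Finite ℤ_[p] (integralClosure ℤ_[p] K) :=
    IsIntegralClosure.finite ℤ_[p] ℚ_[p] K _
  have h2 : finrank ℤ_[p] (integralClosure ℤ_[p] K) = 2 :=
    (IsIntegralClosure.rank ℤ_[p] ℚ_[p] K _).trans hquad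
  have hloc : IsLocalization (Algebra.algebraMapSubmonoid (integralClosure ℤ_[p] K)
      (nonZeroDivisors ℤ_[p])) K := IsIntegralClosure.isLocalization ℤ_[p] ℚ_[p] K _
  have hc : Nat.card (ResidueField (integralClosure ℤ_[p] K)) = p ^ 2 := hunram
  have hN : ∀ x : integralClosure ℤ_[p] K, Algebra.norm ℚ_[p] (x : K) =
      ((Algebra.norm ℤ_[p] x : ℤ_[p]) : ℚ_[p]) := fun x =>
    Algebra.norm_localization ℤ_[p] (nonZeroDivisors ℤ_[p]) x
  unfold charConductor padicCharConductor
  congr 1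
  ext i
  simp only [Set.mem_setOf_eq, MonoidHom.comp_apply]
  constructor
  · intro h
    have hW : ∀ k, ∀ u ∈ unitLevelSet p K (i + k),
        φ (Units.map (Algebra.norm ℚ_[p] (S := K)) u) = 1 := by
      intro k u hu
      apply h
      rw [aux_memW h2 hc] at hu ⊢
      obtain ⟨v, hv, t, ht⟩ := hu
      refine ⟨v, hv, algebraMap ℤ_[p] _ (p ^ k) * t, ?_⟩
      rw [ht, pow_add, map_mul, mul_assoc]
    obtain ⟨n, hn⟩ := hφ
    have hstep : ∀ k, (∀ u ∈ padicUnitLevelSet p (i + k + 1), φ u = 1) →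
        ∀ u ∈ padicUnitLevelSet p (i + k), φ u = 1 := by
      intro k hk u hu
      rw [aux_memV] at hu
      obtain ⟨v, hv, y, hy⟩ := hu
      obtain ⟨w, hw, z, hz⟩ := aux_approx (S := integralClosure ℤ_[p] K) h2 hc (i + k) v y hy
      let w' : Kˣ := Units.map (algebraMap (integralClosure ℤ_[p] K) K).toMonoidHom w
      have h1 := hW k w' ((aux_memW h2 hc _ _).mpr ⟨w, rfl, hw⟩)
      let n : ℤ_[p]ˣ := Units.map (Algebra.norm ℤ_[p] (S := integralClosure ℤ_[p] K)) w
      have hnw : ((n : ℤ_[p]) : ℚ_[p]) = (Units.map (Algebra.norm ℚ_[p] (S := K)) w' : ℚ_[p]ˣ) :=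
        (hN w).symm
      have h3 := hk (u * (Units.map (Algebra.norm ℚ_[p] (S := K)) w')⁻¹) (by
        rw [aux_memV]
        refine ⟨v * n⁻¹, ?_, z * (n⁻¹ : ℤ_[p]ˣ), ?_⟩
        · have h5 : ((Units.map (Algebra.norm ℚ_[p] (S := K)) w' : ℚ_[p]ˣ) : ℚ_[p]) ≠ 0 :=
            Units.ne_zero _
          rw [Units.val_mul, Units.val_mul, Units.val_inv_eq_inv_val,
            eq_mul_inv_iff_mul_eq₀ h5, ← hnw, ← hv, ← PadicInt.coe_mul, mul_assoc, Units.inv_mul,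
            mul_one]
        · have hz' : (v : ℤ_[p]) = n + p ^ (i + k + 1) * z := hz
          rw [Units.val_mul, hz', add_mul, Units.mul_inv, mul_assoc])
      rw [map_mul, map_inv, h1, inv_one, mul_one] at h3
      exact h3
    have hall : ∀ k, (∀ u ∈ padicUnitLevelSet p (i + k), φ u = 1) →
        ∀ u ∈ padicUnitLevelSet p i, φ u = 1 := by
      intro k
      induction k with
      | zero => exact id
      | succ k ih => exact fun hk => ih (hstep k hk)
    apply hall n
    have hup : ∀ k, ∀ u ∈ padicUnitLevelSet p (k + n), φ u = 1 := by
      intro k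
      induction k with
      | zero => simpa using hn
      | succ k ih =>
        intro u hu
        rw [add_right_comm] at hu
        exact ih u (aux_V_succ hu)
    exact hup i
  · intro h u hu
    rw [aux_memW h2 hc] at hu
    obtain ⟨w, hw, t, ht⟩ := hu
    apply h
    rw [aux_memV]
    refine ⟨Units.map (Algebra.norm ℤ_[p] (S := integralClosure ℤ_[p] K)) w, ?_,
      Algebra.trace ℤ_[p] _ t + p ^ i * Algebra.norm ℤ_[p] t, ?_⟩
    · rw [Units.coe_map, Units.coe_map, ← hw]
      exact (hN w).symm
    · rw [Units.coe_map]
      change Algebra.norm ℤ_[p] (w : integralClosure ℤ_[p] K) = _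
      rw [ht, aux_norm_one_add_mul h2]
      ring
end
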